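/- arXiv:1904.08077 — 2 statements merged into one kernel-verified Lean document; each statement's English description precedes it below -/
import Mathlib

section
/- Let (W, S) be a Coxeter system with length function ℓ. Let w ∈ W and s ∈ S satisfy ℓ(w s) > ℓ(w). Suppose the set of right inversions of w is stable under conjugation by s, i.e., for every reflection t of W, t is a right inversion of w if and only if s t s is a right inversion of w. Then w s w⁻¹ ∈ S; equivalently, w s = t w for some simple reflection t ∈ S. -/
namespace CoxeterSystem

open List

variable {B : Type*} {W : Type*} [Group W] {M : CoxeterMatrix B} (cs : CoxeterSystem M W)

open Classical in
/-- The involution `(t, ε) ↦ (s t s, ε + [t = s])` of `W × ZMod 2` attached to the simple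
reflection `s = s i`. -/
noncomputable def signedConj (i : B) : Equiv.Perm (W × ZMod 2) :=
  Function.Involutive.toPerm
    (fun p => (cs.simple i * p.1 * cs.simple i, p.2 + if p.1 = cs.simple i then 1 else 0)) <| by
    rintro ⟨t, ε⟩
    have h : cs.simple i * t * cs.simple i = cs.simple i ↔ t = cs.simple i := by
      rw [mul_eq_right, mul_eq_one_iff_eq_inv', cs.inv_simple]
    ext
    · simp [mul_assoc]
    · simp only [h, add_assoc, CharTwo.add_self_eq_zero, add_zero]

open Classical in
theorem signedConj_apply (i : B) (t : W) (ε : ZMod 2) :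
    cs.signedConj i (t, ε) =
      (cs.simple i * t * cs.simple i, ε + if t = cs.simple i then 1 else 0) := rfl

open Classical in
theorem signedConj_mul_signedConj_pow_apply (i j : B) (k : ℕ) (t : W) (ε : ZMod 2) :
    ((cs.signedConj i * cs.signedConj j) ^ k) (t, ε) =
      ((cs.simple i * cs.simple j) ^ k * t * ((cs.simple i * cs.simple j) ^ k)⁻¹,
        ε + ∑ n ∈ Finset.range (2 * k),
          if t = cs.simple j * (cs.simple i * cs.simple j) ^ n then 1 else 0) := by
  induction k with
  | zero => simp
  | succ k ih =>
    set p := cs.simple i * cs.simple j with hp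
    have hconj : cs.simple j * p * cs.simple j = p⁻¹ := by simp [hp, mul_assoc]
    have hpow (n : ℕ) : p ^ n * cs.simple j = cs.simple j * (p ^ n)⁻¹ := by
      have h : cs.simple j * p ^ n * (cs.simple j)⁻¹ = (p ^ n)⁻¹ := by
        rw [← conj_pow, cs.inv_simple, hconj, inv_pow]
      rw [← h, cs.inv_simple]
      simp [mul_assoc]
    have hpow' (n : ℕ) : (p ^ n)⁻¹ * cs.simple j = cs.simple j * p ^ n := by
      rw [inv_mul_eq_iff_eq_mul, ← mul_assoc, hpow, mul_assoc, inv_mul_cancel, mul_one]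
    have h₁ : p ^ k * t * (p ^ k)⁻¹ = cs.simple j ↔ t = cs.simple j * p ^ (2 * k) := by
      rw [mul_inv_eq_iff_eq_mul, ← eq_inv_mul_iff_mul_eq, ← mul_assoc, hpow', mul_assoc,
        ← pow_add, two_mul]
    have h₂ : cs.simple j * (p ^ k * t * (p ^ k)⁻¹) * cs.simple j = cs.simple i ↔
        t = cs.simple j * p ^ (2 * k + 1) := by
      have hi : cs.simple i = p * cs.simple j := by simp [hp]
      rw [hi, mul_left_inj, ← eq_inv_mul_iff_mul_eq, cs.inv_simple, mul_inv_eq_iff_eq_mul,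
        ← eq_inv_mul_iff_mul_eq, ← mul_assoc, ← mul_assoc, hpow', mul_assoc, mul_assoc,
        ← pow_succ', ← pow_add]
      congr! 3
      omega
    rw [pow_succ', Equiv.Perm.mul_apply, ih, Equiv.Perm.mul_apply, signedConj_apply,
      signedConj_apply, show 2 * (k + 1) = 2 * k + 1 + 1 by ring, Finset.sum_range_succ,
      Finset.sum_range_succ]
    simp only [h₁, h₂]
    ext
    · simp [hp, pow_succ', mul_assoc]
    · simp only [add_assoc]

theorem isLiftable_signedConj : M.IsLiftable cs.signedConj := by
  classical
  intro i j
  ext1 ⟨t, ε⟩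
  rw [signedConj_mul_signedConj_pow_apply, two_mul, Finset.sum_range_add]
  simp [pow_add, CharTwo.add_self_eq_zero]

/-- The action of `W` on `W × ZMod 2` extending `CoxeterSystem.signedConj`. -/
noncomputable def signedConjHom : W →* Equiv.Perm (W × ZMod 2) :=
  cs.lift ⟨cs.signedConj, cs.isLiftable_signedConj⟩

/-- The reflection cocycle: the class mod 2 of the number of occurrences of `t` in the right
inversion sequence of any word for `w`. -/
noncomputable def inversionParity (w t : W) : ZMod 2 := (cs.signedConjHom w (t, 0)).2

theorem signedConjHom_simple (i : B) : cs.signedConjHom (cs.simple i) = cs.signedConj i :=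
  cs.lift_apply_simple cs.isLiftable_signedConj i

open Classical in
theorem signedConjHom_wordProd_apply (ω : List B) (t : W) (ε : ZMod 2) :
    cs.signedConjHom (cs.wordProd ω) (t, ε) =
      (cs.wordProd ω * t * (cs.wordProd ω)⁻¹, ε + (cs.rightInvSeq ω).count t) := by
  induction ω with
  | nil => simp
  | cons i ω ih =>
    have h : cs.wordProd ω * t * (cs.wordProd ω)⁻¹ = cs.simple i ↔
        (cs.wordProd ω)⁻¹ * cs.simple i * cs.wordProd ω = t := by
      rw [mul_inv_eq_iff_eq_mul, mul_assoc, inv_mul_eq_iff_eq_mul, eq_comm]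
    rw [cs.wordProd_cons, map_mul, Equiv.Perm.mul_apply, ih, signedConjHom_simple,
      signedConj_apply, rightInvSeq, count_cons]
    ext
    · simp [mul_assoc]
    · simp [h, add_assoc]

open Classical in
theorem inversionParity_wordProd (ω : List B) (t : W) :
    cs.inversionParity (cs.wordProd ω) t = (cs.rightInvSeq ω).count t := by
  simp [inversionParity, signedConjHom_wordProd_apply]

theorem signedConjHom_apply (w t : W) (ε : ZMod 2) :
    cs.signedConjHom w (t, ε) = (w * t * w⁻¹, ε + cs.inversionParity w t) := by
  classical
  obtain ⟨ω, rfl⟩ := cs.wordProd_surjective w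
  rw [signedConjHom_wordProd_apply, inversionParity_wordProd]

theorem inversionParity_mul (u v t : W) :
    cs.inversionParity (u * v) t =
      cs.inversionParity v t + cs.inversionParity u (v * t * v⁻¹) := by
  rw [inversionParity, map_mul, Equiv.Perm.mul_apply, signedConjHom_apply, signedConjHom_apply,
    zero_add]

open Classical in
theorem inversionParity_simple (i : B) (t : W) :
    cs.inversionParity (cs.simple i) t = if t = cs.simple i then 1 else 0 := by
  simp [inversionParity, signedConjHom_simple, signedConj_apply]

theorem inversionParity_inv_add (w t : W) :
    cs.inversionParity w⁻¹ t + cs.inversionParity w (w⁻¹ * t * w) = 0 := by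
  have h := cs.inversionParity_mul w w⁻¹ t
  rw [mul_inv_cancel, inv_inv] at h
  rw [← h]
  simp [inversionParity]

theorem inversionParity_conj_simple (w : W) (i : B) (t : W) :
    cs.inversionParity (w * cs.simple i * w⁻¹) t =
      cs.inversionParity w⁻¹ t + (cs.inversionParity (cs.simple i) (w⁻¹ * t * w) +
        cs.inversionParity w (cs.simple i * (w⁻¹ * t * w) * cs.simple i)) := by
  rw [inversionParity_mul, inversionParity_mul, inv_inv, cs.inv_simple]

theorem IsReflection.inversionParity_self {cs : CoxeterSystem M W} {t : W}
    (ht : cs.IsReflection t) : cs.inversionParity t t = 1 := by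
  obtain ⟨u, i, rfl⟩ := ht
  have h := cs.inversionParity_inv_add u (u * cs.simple i * u⁻¹)
  have hu : u⁻¹ * (u * cs.simple i * u⁻¹) * u = cs.simple i := by group
  rw [hu] at h
  rw [inversionParity_conj_simple, hu, cs.simple_mul_simple_self, one_mul, add_left_comm, h,
    inversionParity_simple]
  simp

theorem isRightInversion_of_inversionParity_ne_zero {w t : W}
    (h : cs.inversionParity w t ≠ 0) : cs.IsRightInversion w t := by
  classical
  obtain ⟨ω, hω, rfl⟩ := cs.exists_isReduced w
  refine cs.isRightInversion_of_mem_rightInvSeq hω ?_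
  by_contra hmem
  rw [inversionParity_wordProd, count_eq_zero_of_not_mem hmem] at h
  exact h Nat.cast_zero

theorem isRightInversion_iff_inversionParity_eq_one {w t : W} (ht : cs.IsReflection t) :
    cs.IsRightInversion w t ↔ cs.inversionParity w t = 1 := by
  refine ⟨fun h => ?_,
    fun h => cs.isRightInversion_of_inversionParity_ne_zero (h ▸ one_ne_zero)⟩
  by_contra hne
  have h₀ : cs.inversionParity w t = 0 := by
    revert hne
    generalize cs.inversionParity w t = a
    revert a
    decide
  refine ht.not_isRightInversion_mul_left_iff.mpr h
    (cs.isRightInversion_of_inversionParity_ne_zero ?_)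
  rw [inversionParity_mul, ht.inversionParity_self, mul_inv_cancel_right, h₀]
  decide

end CoxeterSystem


/-!
Let `(W, S)` be a Coxeter system with length function `ℓ`, let `w ∈ W` and `s ∈ S` with
`ℓ(w s) > ℓ(w)`.  If the set of right inversions of `w` is stable under conjugation by `s`
(i.e. for every reflection `t`, `t` is a right inversion of `w` iff `s t s` is), then
`w s w⁻¹` is a simple reflection, i.e. `w s = t w` for some `t ∈ S`.
-/
theorem inversion_set_stable_imp_conj_simple
    {B : Type*} {W : Type*} [Group W] {M : CoxeterMatrix B} (cs : CoxeterSystem M W)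
    (w : W) (i : B)
    (hlen : cs.length w < cs.length (w * cs.simple i))
    (hstab : ∀ t : W, cs.IsReflection t →
      (cs.IsRightInversion w t ↔
        cs.IsRightInversion w (cs.simple i * t * cs.simple i))) :
    ∃ j : B, w * cs.simple i * w⁻¹ = cs.simple j := by
  set x := w * cs.simple i * w⁻¹ with hx
  have hx_refl : cs.IsReflection x := ⟨w, i, rfl⟩
  have hinv : ∀ t, cs.IsRightInversion x t → t = x := by
    intro t ht
    have ht' : cs.IsReflection (w⁻¹ * t * w) := by simpa using ht.1.conj w⁻¹
    have hst : cs.IsReflection (cs.simple i * (w⁻¹ * t * w) * cs.simple i) := by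
      simpa using ht'.conj (cs.simple i)
    have hiff := hstab _ ht'
    rw [cs.isRightInversion_iff_inversionParity_eq_one ht',
      cs.isRightInversion_iff_inversionParity_eq_one hst] at hiff
    have heq : cs.inversionParity w (cs.simple i * (w⁻¹ * t * w) * cs.simple i) =
        cs.inversionParity w (w⁻¹ * t * w) := by
      generalize cs.inversionParity w _ = a at hiff ⊢
      generalize cs.inversionParity w _ = b at hiff ⊢
      revert a b
      decide
    have hpar := (cs.isRightInversion_iff_inversionParity_eq_one ht.1).mp ht
    rw [hx, cs.inversionParity_conj_simple, heq, add_left_comm, cs.inversionParity_inv_add,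
      add_zero, cs.inversionParity_simple] at hpar
    have h : w⁻¹ * t * w = cs.simple i := by
      by_contra hne
      simp [hne] at hpar
    rw [hx, ← h]
    group
  obtain ⟨ω, hω, hxω⟩ := cs.exists_isReduced x
  have hle : cs.length x ≤ 1 := by
    have hsub : ∀ t ∈ cs.rightInvSeq ω, t = x := fun t ht =>
      hinv t (hxω ▸ cs.isRightInversion_of_mem_rightInvSeq hω ht)
    have hnodup := hω.nodup_rightInvSeq
    rw [List.eq_replicate_of_mem hsub, List.nodup_replicate, cs.length_rightInvSeq] at hnodup
    rwa [hxω, hω.eq]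
  exact cs.length_eq_one_iff.mp (le_antisymm hle hx_refl.odd_length.pos)
end

section
/- Let J ⊆ I, let l ∈ I with s = s_l and α = (l, l+1), and let w ∈ Y^J be such that s w ∈ Y^J and ℓ(s w) > ℓ(w). Set Bs = Φ_{w_J w⁻¹}^- ∖ Φ_{w_J w⁻¹ s}^- (the set of positive roots β with w_J w⁻¹(β) negative and w_J w⁻¹ s(β) positive, where permutations act on ℤ^n by permuting coordinates). Then: (1) Bs is nonempty; and (2) if β_H ∈ Bs has maximal height among elements of Bs (the height of (i,j) being j − i), then the standard inner product ⟨β_H, α⟩ of the corresponding vectors in ℤ^n is negative, and for all β, β′ ∈ Bs one has β_H + s(β) ≠ s(β′) in ℤ^n. -/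
noncomputable section
open scoped Classical

variable (m : ℕ)

/-- The number of inversions (= the length `ℓ(w)`) of a permutation of `{1,…,n}`,
`n = m + 1`. -/
def len (w : Equiv.Perm (Fin (m + 1))) : ℕ :=
  ((Finset.univ : Finset (Fin (m + 1) × Fin (m + 1))).filter
    fun q => q.1 < q.2 ∧ w q.2 < w q.1).card

/-- The simple reflection `s_i = (i, i+1)`. -/
def simpl (i : Fin m) : Equiv.Perm (Fin (m + 1)) := Equiv.swap i.castSucc i.succ

/-- The standard parabolic subgroup `W_J` of `S_n`. -/
def WJ (J : Set (Fin m)) : Subgroup (Equiv.Perm (Fin (m + 1))) :=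
  Subgroup.closure (simpl m '' J)

/-- `w_J`: the longest element of `W_J` (an element of `W_J` of maximal length). -/
def wJel (J : Set (Fin m)) : Equiv.Perm (Fin (m + 1)) :=
  Classical.choose
    ((Set.toFinite ((WJ m J : Set (Equiv.Perm (Fin (m + 1)))))).toFinset.exists_max_image
      (len m) ⟨1, by rw [Set.Finite.mem_toFinset]; exact (WJ m J).one_mem⟩)

/-- `Y^J = {x ∈ W^J : R(x w_J) = J}`. -/
def YJ (J : Set (Fin m)) : Set (Equiv.Perm (Fin (m + 1))) :=
  {x | (∀ u ∈ WJ m J, len m x ≤ len m (x * u)) ∧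
    {i : Fin m | len m (x * wJel m J * simpl m i) < len m (x * wJel m J)} = J}

/-- `Φ_w^- = {(i,j) : i < j, w i > w j}`. -/
def PhiNeg (w : Equiv.Perm (Fin (m + 1))) : Set (Fin (m + 1) × Fin (m + 1)) :=
  {q | q.1 < q.2 ∧ w q.2 < w q.1}

/-- The height of the root `(i,j)`, namely `j - i`. -/
def rootHt (q : Fin (m + 1) × Fin (m + 1)) : ℕ := (q.2 : ℕ) - (q.1 : ℕ)

/-- The root `(i,j)` as the vector `e_i - e_j ∈ ℤ^n`. -/
def rootVec (q : Fin (m + 1) × Fin (m + 1)) : Fin (m + 1) → ℤ :=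
  fun t => (if t = q.1 then 1 else 0) - (if t = q.2 then 1 else 0)

end

section SimpleReflections

variable {m : ℕ}

theorem simpl_apply_castSucc (l : Fin m) : simpl m l l.castSucc = l.succ :=
  Equiv.swap_apply_left _ _

theorem simpl_apply_succ (l : Fin m) : simpl m l l.succ = l.castSucc :=
  Equiv.swap_apply_right _ _

theorem simpl_apply_of_ne (l : Fin m) {x : Fin (m + 1)} (h₁ : x ≠ l.castSucc) (h₂ : x ≠ l.succ) :
    simpl m l x = x :=
  Equiv.swap_apply_of_ne_of_ne h₁ h₂

theorem simpl_mul_self (l : Fin m) : simpl m l * simpl m l = 1 :=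
  Equiv.swap_mul_self _ _

theorem simpl_inv (l : Fin m) : (simpl m l)⁻¹ = simpl m l :=
  Equiv.swap_inv _ _

theorem simpl_apply_cases (l : Fin m) (x : Fin (m + 1)) :
    (x = l.castSucc ∧ simpl m l x = l.succ) ∨ (x = l.succ ∧ simpl m l x = l.castSucc) ∨
      (x ≠ l.castSucc ∧ x ≠ l.succ ∧ simpl m l x = x) := by
  by_cases h₁ : x = l.castSucc
  · exact Or.inl ⟨h₁, h₁ ▸ simpl_apply_castSucc l⟩
  · by_cases h₂ : x = l.succ
    · exact Or.inr (Or.inl ⟨h₂, h₂ ▸ simpl_apply_succ l⟩)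
    · exact Or.inr (Or.inr ⟨h₁, h₂, simpl_apply_of_ne l h₁ h₂⟩)

/-- A simple reflection reverses the order of no pair other than `(l, l+1)`. -/
theorem eq_of_lt_of_simpl_lt (l : Fin m) {x y : Fin (m + 1)} (h : x < y)
    (hs : simpl m l y < simpl m l x) : x = l.castSucc ∧ y = l.succ := by
  rcases simpl_apply_cases l x with ⟨hx, hx'⟩ | ⟨hx, hx'⟩ | ⟨hx, hx₂, hx'⟩ <;>
  rcases simpl_apply_cases l y with ⟨hy, hy'⟩ | ⟨hy, hy'⟩ | ⟨hy, hy₂, hy'⟩ <;>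
  rw [hx', hy'] at hs <;>
  simp only [Fin.ext_iff, Fin.lt_def, Fin.val_castSucc, Fin.val_succ, ne_eq] at * <;>
  omega

end SimpleReflections

section Length

variable {m : ℕ}

theorem len_inv (w : Equiv.Perm (Fin (m + 1))) : len m w⁻¹ = len m w := by
  unfold len
  refine Finset.card_bij' (fun q _ => (w⁻¹ q.2, w⁻¹ q.1)) (fun q _ => (w q.2, w q.1)) ?_ ?_ ?_ ?_
  · rintro ⟨i, j⟩ h
    simpa [and_comm] using h
  · rintro ⟨i, j⟩ h
    simpa [and_comm] using h
  · rintro ⟨i, j⟩ h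
    simp
  · rintro ⟨i, j⟩ h
    simp

theorem len_simpl_mul_lt (l : Fin m) (w : Equiv.Perm (Fin (m + 1)))
    (h : w⁻¹ l.succ < w⁻¹ l.castSucc) : len m (simpl m l * w) < len m w := by
  unfold len
  refine Finset.card_lt_card (Finset.ssubset_iff_of_subset ?_ |>.2 ?_)
  · rintro ⟨i, j⟩ hq
    rw [Finset.mem_filter] at hq ⊢
    replace hq := hq.2
    refine ⟨Finset.mem_univ _, ?_⟩
    refine ⟨hq.1, lt_of_not_ge fun hle => ?_⟩
    obtain ⟨hi, hj⟩ := eq_of_lt_of_simpl_lt l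
      (lt_of_le_of_ne hle fun he => hq.1.ne (w.injective he)) hq.2
    simp only [← hi, ← hj, Equiv.Perm.coe_inv, Equiv.symm_apply_apply] at h
    exact lt_asymm h hq.1
  · refine ⟨(w⁻¹ l.succ, w⁻¹ l.castSucc), ?_, ?_⟩
    · rw [Finset.mem_filter]
      simpa [Fin.castSucc_lt_succ] using h
    · rw [Finset.mem_filter]
      simp [simpl_apply_castSucc, simpl_apply_succ, Fin.castSucc_lt_succ.le]

theorem len_mul_simpl_lt (w : Equiv.Perm (Fin (m + 1))) (l : Fin m)
    (h : w l.succ < w l.castSucc) : len m (w * simpl m l) < len m w := by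
  have := len_simpl_mul_lt l w⁻¹ (by simpa using h)
  rwa [← len_inv (w * simpl m l), mul_inv_rev, simpl_inv, ← len_inv w]

theorem len_lt_mul_simpl (w : Equiv.Perm (Fin (m + 1))) (l : Fin m)
    (h : w l.castSucc < w l.succ) : len m w < len m (w * simpl m l) := by
  have := len_mul_simpl_lt (w * simpl m l) l
    (by simpa [simpl_apply_castSucc, simpl_apply_succ] using h)
  rwa [mul_assoc, simpl_mul_self, mul_one] at this

theorem apply_castSucc_lt_of_len_le {w : Equiv.Perm (Fin (m + 1))} {l : Fin m}
    (h : len m w ≤ len m (w * simpl m l)) : w l.castSucc < w l.succ :=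
  lt_of_le_of_ne (le_of_not_gt fun hlt => (len_mul_simpl_lt w l hlt).not_ge h)
    fun he => Fin.castSucc_lt_succ.ne (w.injective he)

theorem apply_succ_lt_of_len_le {w : Equiv.Perm (Fin (m + 1))} {l : Fin m}
    (h : len m (w * simpl m l) ≤ len m w) : w l.succ < w l.castSucc :=
  lt_of_le_of_ne (le_of_not_gt fun hlt => (len_lt_mul_simpl w l hlt).not_ge h)
    fun he => Fin.castSucc_lt_succ.ne' (w.injective he)

end Length

theorem Fin.rel_of_forall_castSucc_succ {m : ℕ} {α : Type*} (r : α → α → Prop) [IsTrans α r]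
    (f : Fin (m + 1) → α) {p q : Fin (m + 1)} (hpq : p < q)
    (h : ∀ k : Fin m, p ≤ k.castSucc → k.castSucc < q → r (f k.castSucc) (f k.succ)) :
    r (f p) (f q) := by
  induction q using Fin.induction with
  | zero => exact absurd hpq (Fin.not_lt_zero p)
  | succ i ih =>
    have hle : p ≤ i.castSucc := Fin.le_castSucc_iff.2 hpq
    have hstep := h i hle Fin.castSucc_lt_succ
    rcases hle.eq_or_lt with rfl | hlt
    · exact hstep
    · exact _root_.trans (ih hlt fun k hk hk' => h k hk (hk'.trans Fin.castSucc_lt_succ)) hstep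

section LongestElement

variable {m : ℕ} {J : Set (Fin m)}

theorem simpl_mem_WJ {k : Fin m} (hk : k ∈ J) : simpl m k ∈ WJ m J :=
  Subgroup.subset_closure ⟨k, hk, rfl⟩

/-- The elements of `W_J` stabilize `{1,…,k}` for every `k ∉ J`. -/
theorem apply_le_castSucc_iff_of_mem_WJ {v : Equiv.Perm (Fin (m + 1))} (hv : v ∈ WJ m J)
    {k : Fin m} (hk : k ∉ J) (x : Fin (m + 1)) : v x ≤ k.castSucc ↔ x ≤ k.castSucc := by
  induction hv using Subgroup.closure_induction generalizing x with
  | mem v hv =>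
    obtain ⟨j, hj, rfl⟩ := hv
    have hjk : (j : ℕ) ≠ k := fun h => hk (Fin.ext h ▸ hj)
    rcases simpl_apply_cases j x with ⟨hx, hx'⟩ | ⟨hx, hx'⟩ | ⟨-, -, hx'⟩
    · rw [hx', hx]
      simp only [Fin.le_def, Fin.val_castSucc, Fin.val_succ]
      omega
    · rw [hx', hx]
      simp only [Fin.le_def, Fin.val_castSucc, Fin.val_succ]
      omega
    · rw [hx']
  | one => rfl
  | mul a b _ _ iha ihb => exact (iha (b x)).trans (ihb x)
  | inv a _ iha => simpa using (iha (a⁻¹ x)).symm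

theorem wJel_mem : wJel m J ∈ WJ m J := by
  have h := Classical.choose_spec
    ((Set.toFinite ((WJ m J : Set (Equiv.Perm (Fin (m + 1)))))).toFinset.exists_max_image
      (len m) ⟨1, by rw [Set.Finite.mem_toFinset]; exact (WJ m J).one_mem⟩)
  exact (Set.Finite.mem_toFinset _).1 h.1

theorem len_le_len_wJel {v : Equiv.Perm (Fin (m + 1))} (hv : v ∈ WJ m J) :
    len m v ≤ len m (wJel m J) := by
  have h := Classical.choose_spec
    ((Set.toFinite ((WJ m J : Set (Equiv.Perm (Fin (m + 1)))))).toFinset.exists_max_image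
      (len m) ⟨1, by rw [Set.Finite.mem_toFinset]; exact (WJ m J).one_mem⟩)
  exact h.2 v ((Set.Finite.mem_toFinset _).2 hv)

theorem wJel_apply_succ_lt {k : Fin m} (hk : k ∈ J) :
    wJel m J k.succ < wJel m J k.castSucc :=
  apply_succ_lt_of_len_le (len_le_len_wJel ((WJ m J).mul_mem wJel_mem (simpl_mem_WJ hk)))

theorem wJel_lt_of_forall_mem {p q : Fin (m + 1)} (hpq : p < q)
    (h : ∀ k : Fin m, p ≤ k.castSucc → k.castSucc < q → k ∈ J) : wJel m J q < wJel m J p :=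
  Fin.rel_of_forall_castSucc_succ (· > ·) (wJel m J) hpq
    fun k hk hk' => wJel_apply_succ_lt (h k hk hk')

theorem wJel_lt_of_notMem {p q : Fin (m + 1)} {k : Fin m} (hk : k ∉ J) (hp : p ≤ k.castSucc)
    (hq : k.castSucc < q) : wJel m J p < wJel m J q :=
  ((apply_le_castSucc_iff_of_mem_WJ wJel_mem hk p).2 hp).trans_lt
    (lt_of_not_ge fun h => hq.not_ge ((apply_le_castSucc_iff_of_mem_WJ wJel_mem hk q).1 h))

theorem wJel_mul_self : wJel m J * wJel m J = 1 := by
  have hmono : StrictMono (wJel m J * wJel m J) := by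
    intro p q hpq
    simp only [Equiv.Perm.mul_apply]
    by_cases h : ∀ k : Fin m, p ≤ k.castSucc → k.castSucc < q → k ∈ J
    · refine wJel_lt_of_forall_mem (wJel_lt_of_forall_mem hpq h) fun k hk hk' => ?_
      by_contra hkJ
      have hq := (apply_le_castSucc_iff_of_mem_WJ wJel_mem hkJ q).1 hk
      exact hk'.not_ge ((apply_le_castSucc_iff_of_mem_WJ wJel_mem hkJ p).2 (hpq.le.trans hq))
    · push Not at h
      obtain ⟨k, hp, hq, hk⟩ := h
      refine wJel_lt_of_notMem hk ((apply_le_castSucc_iff_of_mem_WJ wJel_mem hk p).2 hp) ?_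
      exact lt_of_not_ge fun h => hq.not_ge ((apply_le_castSucc_iff_of_mem_WJ wJel_mem hk q).1 h)
  have := Subsingleton.elim
    (hmono.orderIsoOfSurjective _ (wJel m J * wJel m J).surjective) (OrderIso.refl _)
  ext x
  exact congrArg (fun e : Fin (m + 1) ≃o Fin (m + 1) => (e x : ℕ)) this

end LongestElement

section YJ

variable {m : ℕ} {J : Set (Fin m)} {l : Fin m} {w : Equiv.Perm (Fin (m + 1))}

theorem apply_castSucc_lt_of_mem_YJ (hw : w ∈ YJ m J) {k : Fin m} (hk : k ∈ J) :
    w k.castSucc < w k.succ :=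
  apply_castSucc_lt_of_len_le (hw.1 _ (simpl_mem_WJ hk))

theorem mem_iff_of_mem_YJ (hw : w ∈ YJ m J) (k : Fin m) :
    k ∈ J ↔ (w * wJel m J) k.succ < (w * wJel m J) k.castSucc := by
  conv_lhs => rw [← hw.2]
  exact ⟨fun h => apply_succ_lt_of_len_le (le_of_lt h), len_mul_simpl_lt _ _⟩

theorem wJel_mul_inv_castSucc_lt (hw : w ∈ YJ m J) (hsw : simpl m l * w ∈ YJ m J)
    (hlen : len m w < len m (simpl m l * w)) :
    (wJel m J * w⁻¹) l.castSucc < (wJel m J * w⁻¹) l.succ := by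
  have hcd : w⁻¹ l.castSucc < w⁻¹ l.succ :=
    lt_of_le_of_ne (le_of_not_gt fun h => lt_asymm hlen (len_simpl_mul_lt l w h))
      fun he => Fin.castSucc_lt_succ.ne (w⁻¹.injective he)
  by_cases h : ∀ k : Fin m, w⁻¹ l.castSucc ≤ k.castSucc → k.castSucc < w⁻¹ l.succ → k ∈ J
  · exfalso
    obtain ⟨k, hk⟩ := Fin.exists_castSucc_eq.2 (hcd.trans_le (Fin.le_last _)).ne
    have hkJ : k ∈ J := h k hk.ge (hk ▸ hcd)
    have hwk : w k.castSucc = l.castSucc := by simp [hk]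
    have hwl : w (w⁻¹ l.succ) = l.succ := w.apply_symm_apply _
    have hsucc : k.succ = w⁻¹ l.succ := by
      refine le_antisymm (Fin.castSucc_lt_iff_succ_le.1 (hk ▸ hcd)) (le_of_not_gt fun hlt => ?_)
      have h₁ := apply_castSucc_lt_of_mem_YJ hw hkJ
      have h₂ : w k.succ < w (w⁻¹ l.succ) :=
        Fin.rel_of_forall_castSucc_succ (· < ·) w hlt fun i hi hi' =>
          apply_castSucc_lt_of_mem_YJ hw
            (h i (hk ▸ (Fin.castSucc_lt_succ.le.trans hi)) hi')
      rw [hwk] at h₁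
      rw [hwl] at h₂
      simp only [Fin.lt_def, Fin.val_castSucc, Fin.val_succ] at h₁ h₂
      omega
    have hs := apply_castSucc_lt_of_mem_YJ hsw hkJ
    rw [Equiv.Perm.mul_apply, Equiv.Perm.mul_apply, hwk, hsucc, hwl,
      simpl_apply_castSucc, simpl_apply_succ] at hs
    exact lt_asymm hs Fin.castSucc_lt_succ
  · push Not at h
    obtain ⟨k, hp, hq, hk⟩ := h
    exact wJel_lt_of_notMem hk hp hq

theorem mul_wJel_apply (x : Fin (m + 1)) :
    (w * wJel m J) ((wJel m J * w⁻¹) x) = x := by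
  have h : (w * wJel m J) * (wJel m J * w⁻¹) = 1 := by
    rw [mul_assoc, ← mul_assoc (wJel m J), wJel_mul_self, one_mul, mul_inv_cancel]
  rw [← Equiv.Perm.mul_apply, h, Equiv.Perm.one_apply]

theorem wJel_mul_inv_not_adjacent (hw : w ∈ YJ m J) (hsw : simpl m l * w ∈ YJ m J) (k : Fin m)
    (h₁ : (wJel m J * w⁻¹) l.castSucc = k.castSucc) (h₂ : (wJel m J * w⁻¹) l.succ = k.succ) :
    False := by
  have hc : (w * wJel m J) k.castSucc = l.castSucc := h₁ ▸ mul_wJel_apply _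
  have hs : (w * wJel m J) k.succ = l.succ := h₂ ▸ mul_wJel_apply _
  have hiff := (mem_iff_of_mem_YJ hw k).symm.trans (mem_iff_of_mem_YJ hsw k)
  rw [mul_assoc, Equiv.Perm.mul_apply (simpl m l), Equiv.Perm.mul_apply (simpl m l), hc, hs,
    simpl_apply_castSucc, simpl_apply_succ] at hiff
  exact lt_asymm Fin.castSucc_lt_succ (hiff.2 Fin.castSucc_lt_succ)

end YJ

section Roots

variable {m : ℕ} {l : Fin m} {g : Equiv.Perm (Fin (m + 1))}

theorem mem_PhiNeg_diff_cases (hg : g l.castSucc < g l.succ) {q : Fin (m + 1) × Fin (m + 1)}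
    (hq : q ∈ PhiNeg m g \ PhiNeg m (g * simpl m l)) :
    (q.1 < l.castSucc ∧ q.2 = l.castSucc) ∨ (q.1 = l.succ ∧ l.succ < q.2) := by
  obtain ⟨i, j⟩ := q
  obtain ⟨⟨hij, hgij⟩, hn⟩ := hq
  have hs : g (simpl m l i) ≤ g (simpl m l j) := le_of_not_gt fun h => hn ⟨hij, h⟩
  have hl : l.castSucc < l.succ := Fin.castSucc_lt_succ
  simp only at hij hgij ⊢
  rcases simpl_apply_cases l i with ⟨hi, hi'⟩ | ⟨hi, hi'⟩ | ⟨hi, hi₂, hi'⟩ <;>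
  rcases simpl_apply_cases l j with ⟨hj, hj'⟩ | ⟨hj, hj'⟩ | ⟨hj, hj₂, hj'⟩ <;>
  (rw [hi', hj'] at hs; clear hi' hj' hn; grind)

theorem PhiNeg_diff_nonempty (hg : g l.castSucc < g l.succ)
    (hadj : ∀ k : Fin m, g l.castSucc = k.castSucc → g l.succ = k.succ → False) :
    (PhiNeg m g \ PhiNeg m (g * simpl m l)).Nonempty := by
  obtain ⟨k, hk⟩ := Fin.exists_castSucc_eq.2 (hg.trans_le (Fin.le_last _)).ne
  obtain ⟨c, hc⟩ := g.surjective k.succ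
  have hlt₁ : g l.castSucc < g c := hc ▸ hk ▸ Fin.castSucc_lt_succ
  have hlt₂ : g c < g l.succ :=
    lt_of_le_of_ne (hc ▸ Fin.castSucc_lt_iff_succ_le.1 (hk ▸ hg))
      fun he => hadj k hk.symm (he ▸ hc)
  have hc₁ : c ≠ l.castSucc := fun h => hlt₁.ne (h ▸ rfl)
  have hc₂ : c ≠ l.succ := fun h => hlt₂.ne (h ▸ rfl)
  have hsc := simpl_apply_of_ne l hc₁ hc₂
  rcases lt_or_gt_of_ne hc₁ with h | h
  · refine ⟨(c, l.castSucc), ⟨h, hlt₁⟩, fun hn => ?_⟩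
    have := hn.2
    simp only [Equiv.Perm.mul_apply, hsc, simpl_apply_castSucc] at this
    exact lt_asymm this hlt₂
  · refine ⟨(l.succ, c), ⟨lt_of_le_of_ne (Fin.castSucc_lt_iff_succ_le.1 h) hc₂.symm, hlt₂⟩,
      fun hn => ?_⟩
    have := hn.2
    simp only [Equiv.Perm.mul_apply, hsc, simpl_apply_succ] at this
    exact lt_asymm this hlt₁

theorem rootVec_sub_of_mem_PhiNeg_diff (hg : g l.castSucc < g l.succ)
    {q : Fin (m + 1) × Fin (m + 1)} (hq : q ∈ PhiNeg m g \ PhiNeg m (g * simpl m l)) :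
    rootVec m q l.castSucc - rootVec m q l.succ = -1 := by
  have hne : l.castSucc ≠ l.succ := Fin.castSucc_lt_succ.ne
  rcases mem_PhiNeg_diff_cases hg hq with ⟨h₁, h₂⟩ | ⟨h₁, h₂⟩
  · have h₃ : l.succ ≠ q.1 := (h₁.trans Fin.castSucc_lt_succ).ne'
    simp [rootVec, h₂, h₁.ne', h₃, hne.symm]
  · have h₃ : l.castSucc ≠ q.2 := (Fin.castSucc_lt_succ.trans h₂).ne
    simp [rootVec, h₁, h₂.ne, h₃, hne]

theorem sum_mul_rootVec (v : Fin (m + 1) → ℤ) (i j : Fin (m + 1)) :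
    ∑ t, v t * rootVec m (i, j) t = v i - v j := by
  simp [rootVec, mul_sub, Finset.sum_sub_distrib]

end Roots

/-- Let `J ⊆ I`, `s = s_l`, `α = (l, l+1)`, and `w ∈ Y^J` with
`s w ∈ Y^J` and `ℓ(s w) > ℓ(w)`.  Put `Bs = Φ_{w_J w⁻¹}^- \ Φ_{w_J w⁻¹ s}^-`.  Then `Bs`
is nonempty; and if `β_H ∈ Bs` has maximal height among elements of `Bs`, then
`⟨β_H, α⟩ < 0`, and `β_H + s(β) ≠ s(β')` in `ℤ^n` for all `β, β' ∈ Bs` (where `s` acts on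
`ℤ^n` by permuting coordinates). -/
theorem clubsuit_property
    (m : ℕ) (J : Set (Fin m)) (l : Fin m) (w : Equiv.Perm (Fin (m + 1)))
    (hw : w ∈ YJ m J) (hsw : simpl m l * w ∈ YJ m J)
    (hlen : len m w < len m (simpl m l * w)) :
    (PhiNeg m (wJel m J * w⁻¹) \ PhiNeg m (wJel m J * w⁻¹ * simpl m l)).Nonempty ∧
    ∀ βH ∈ PhiNeg m (wJel m J * w⁻¹) \ PhiNeg m (wJel m J * w⁻¹ * simpl m l),
      (∀ β ∈ PhiNeg m (wJel m J * w⁻¹) \ PhiNeg m (wJel m J * w⁻¹ * simpl m l),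
        rootHt m β ≤ rootHt m βH) →
      ((∑ t : Fin (m + 1), rootVec m βH t * rootVec m (l.castSucc, l.succ) t) < 0 ∧
        ∀ β ∈ PhiNeg m (wJel m J * w⁻¹) \ PhiNeg m (wJel m J * w⁻¹ * simpl m l),
          ∀ β' ∈ PhiNeg m (wJel m J * w⁻¹) \ PhiNeg m (wJel m J * w⁻¹ * simpl m l),
            (fun t => rootVec m βH t + rootVec m β (simpl m l t)) ≠
              (fun t => rootVec m β' (simpl m l t))) := by
  have hg := wJel_mul_inv_castSucc_lt hw hsw hlen
  refine ⟨PhiNeg_diff_nonempty hg (wJel_mul_inv_not_adjacent hw hsw),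
    fun βH hβH _ => ⟨?_, fun β hβ β' hβ' heq => ?_⟩⟩
  · rw [sum_mul_rootVec, rootVec_sub_of_mem_PhiNeg_diff hg hβH]
    decide
  · have h₁ := congrFun heq l.castSucc
    have h₂ := congrFun heq l.succ
    simp only [simpl_apply_castSucc, simpl_apply_succ] at h₁ h₂
    have hH := rootVec_sub_of_mem_PhiNeg_diff hg hβH
    have hb := rootVec_sub_of_mem_PhiNeg_diff hg hβ
    have hb' := rootVec_sub_of_mem_PhiNeg_diff hg hβ'
    omega
end
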